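/- arXiv:1712.10017 — 2 statements merged into one kernel-verified Lean document; each statement's English description precedes it below -/
import Mathlib

section
/- Let q = 2^m with m ≥ 3, and let α, β ∈ F_{q^2} with αβ ≠ 0. The polynomial f(x) = x + α·x^{q(q-1)+1} + β·x^{2(q-1)+1} permutes F_{q^2} if and only if either (1) β = α^{q-1} and Tr(1 + 1/α^{q+1}) = 0, or (2) β(1 + α^{q+1} + β^{q+1}) + α^{2q} = 0, β^{q+1} ≠ 1, and Tr(β^{q+1}/α^{q+1}) = 0. -/
/-- The absolute trace `Tr(z) = z + z^2 + z^4 + ⋯ + z^{2^{m-1}}`, computed inside the field. -/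
def traceSum {F : Type*} [Field F] (m : ℕ) (z : F) : F :=
  ∑ j ∈ Finset.range m, z ^ 2 ^ j

/-- A field of characteristic two with an involution `conj` and an additive map `tr`, behaving like
`𝔽_{q²}` with the conjugation `x ↦ x^q` and the trace sum `z + z² + ⋯ + z^{q/2}`. -/
structure ConjTrace (E : Type*) [Field E] where
  conj : E →+* E
  tr : E →+ E
  conj_conj : ∀ x, conj (conj x) = x
  tr_sq_add_self : ∀ y, tr (y ^ 2 + y) = conj y + y
  exists_sq_add_self : ∀ c, conj c = c → ∃ v, v ^ 2 + v = c
  exists_sq : ∀ x : E, ∃ y, y ^ 2 = x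
  eq_zero_of_tr_const : ∀ δ c : E,
    (∀ ζ, ζ * conj ζ = 1 → tr (δ * ζ + conj (δ * ζ)) = c) → δ = 0

namespace ConjTrace

variable {E : Type*} [Field E] [CharP E 2] (S : ConjTrace E)

/-- The invariant of the cubic `e z³ + z² + z + conj e` whose trace decides its roots of norm one. -/
def invariant (e : E) : E := (1 + e) * (1 + S.conj e) / (1 + e * S.conj e) ^ 2 + 1

/-- `z` is a root of norm one of the cubic `e z³ + z² + z + conj e`. -/
def IsUnitRoot (e z : E) : Prop :=
  z * S.conj z = 1 ∧ e * z ^ 3 + z ^ 2 + z + S.conj e = 0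

lemma tr_sq_add_of_fixed {x : E} (hx : S.conj x = x) : S.tr (x ^ 2 + x) = 0 := by
  rw [S.tr_sq_add_self, hx, CharTwo.add_self_eq_zero]

lemma tr_sq_of_fixed {x : E} (hx : S.conj x = x) : S.tr (x ^ 2) = S.tr x := by
  have := S.tr_sq_add_of_fixed hx
  rw [map_add] at this
  grind

lemma conj_eq_or_of_sq_add_self {v c : E} (hc : S.conj c = c) (hv : v ^ 2 + v = c) :
    S.conj v = v ∨ S.conj v = v + 1 := by
  have h : S.conj v ^ 2 + S.conj v = c := by rw [← map_pow, ← map_add, hv, hc]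
  grind

omit [CharP E 2] in
lemma isUnit_root_ne_zero {z : E} (hz : z * S.conj z = 1) : z ≠ 0 := by
  rintro rfl
  simp at hz

omit [CharP E 2] in
lemma conj_mul_conj (p : E) : S.conj (p * S.conj p) = p * S.conj p := by
  rw [map_mul, S.conj_conj, mul_comm]

omit [CharP E 2] in
lemma conj_ne_zero {x : E} (hx : x ≠ 0) : S.conj x ≠ 0 := by simpa using hx

/-- Half of the coefficients of the quadratic cofactor at the root `z`, suitably normalised. -/
def cofactor (e z : E) : E := e * z / (1 + e * z)

lemma one_add_mul_ne_zero {e z : E} (hz : S.IsUnitRoot e z) (hN : e * S.conj e ≠ 1) :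
    1 + e * z ≠ 0 := by
  obtain ⟨hz1, hz⟩ := hz
  intro h
  have h' := congrArg S.conj h
  simp only [map_add, map_mul, map_one, map_zero] at h'
  generalize S.conj e = e' at *
  generalize S.conj z = z' at *
  grind

lemma invariant_eq_aux {k l z z' : E} (hz : z * z' = 1) (hk : z * (1 + k) = 1 + l)
    (h1 : 1 + k ≠ 0) (hN : 1 + k * l ≠ 0) :
    (1 + k * z') * (1 + l * z) / (1 + k * l) ^ 2 + 1 =
      k / (1 + k) * (l / (1 + l)) + (((k + l) / (1 + k * l)) ^ 2 + (k + l) / (1 + k * l)) := by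
  have hz0 : z ≠ 0 := left_ne_zero_of_mul_eq_one hz
  have h1' : 1 + l ≠ 0 := hk ▸ mul_ne_zero hz0 h1
  have hX : (1 + k * z') * (1 + l * z) =
      ((1 + l) + (1 + k) * k) * ((1 + k) + (1 + l) * l) / ((1 + k) * (1 + l)) := by
    have hz1 : z = (1 + l) / (1 + k) := by field_simp; exact hk
    have hz2 : z' = (1 + k) / (1 + l) := by
      field_simp
      linear_combination (-z') * hk + (1 + k) * hz
    rw [hz1, hz2]
    field_simp
  rw [hX]
  field_simp
  clear hX hk hz hz0
  grind

lemma tr_invariant {e z : E} (hz : S.IsUnitRoot e z) (hN : e * S.conj e ≠ 1) :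
    S.tr (S.invariant e) = S.tr (cofactor e z * S.conj (cofactor e z)) := by
  have hne := S.one_add_mul_ne_zero hz hN
  obtain ⟨hz1, hz⟩ := hz
  have hk : z * (1 + e * z) = 1 + S.conj e * S.conj z := by
    generalize S.conj e = e' at *
    generalize S.conj z = z' at *
    grind
  have hee : e * z * (S.conj e * S.conj z) = e * S.conj e := by
    linear_combination e * S.conj e * hz1
  have hN' : 1 + e * S.conj e ≠ 0 := fun h => hN (by grind)
  have key := invariant_eq_aux (k := e * z) (l := S.conj e * S.conj z) hz1 hk hne (by rwa [hee])
  rw [show e * z * S.conj z = e by linear_combination e * hz1,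
    show S.conj e * S.conj z * z = S.conj e by linear_combination S.conj e * hz1, hee] at key
  rw [invariant, key, map_add, tr_sq_add_of_fixed, add_zero]
  · simp only [cofactor, map_div₀, map_add, map_mul, map_one]
  · simp only [map_div₀, map_add, map_mul, map_one, S.conj_conj]
    ring

lemma cofactor_quadratic_iff {e z w : E} (hz : S.IsUnitRoot e z) (hN : e * S.conj e ≠ 1)
    (hw : w ≠ 1) : e * (z * w) ^ 3 + (z * w) ^ 2 + z * w + S.conj e = 0 ↔
      cofactor e z * w ^ 2 + w + S.conj (cofactor e z) = 0 := by
  have hne := S.one_add_mul_ne_zero hz hN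
  have hne' : 1 + S.conj e * S.conj z ≠ 0 := by simpa using S.conj_ne_zero hne
  have hz0 := S.isUnit_root_ne_zero hz.1
  obtain ⟨hz1, hz⟩ := hz
  have hp : cofactor e z * (1 + e * z) = e * z := by rw [cofactor]; field_simp
  have hp' : S.conj (cofactor e z) * (1 + S.conj e * S.conj z) = S.conj e * S.conj z := by
    simpa using congrArg S.conj hp
  generalize S.conj (cofactor e z) = p' at *
  generalize cofactor e z = p at *
  generalize S.conj e = e' at *
  generalize S.conj z = z' at *
  have hk : z * (1 + e * z) = 1 + e' * z' := by grind
  have hp2 : p' * (1 + e * z) = e' * z' ^ 2 := by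
    rw [← hk] at hp'
    linear_combination z' * hp' - p' * (1 + e * z) * hz1
  have key : e * (z * w) ^ 3 + (z * w) ^ 2 + z * w + e' =
      z ^ 2 * (1 + e * z) * ((w + 1) * (p * w ^ 2 + w + p')) := by
    have : e' = e * z ^ 3 + z ^ 2 + z := by grind
    subst this
    have h3 : z ^ 2 * z' ^ 2 = 1 := by rw [← mul_pow, hz1, one_pow]
    have e1 : z ^ 2 * (1 + e * z) * ((w + 1) * (p * w ^ 2 + w + p')) =
      z ^ 2 * (w + 1) * (e * z * w ^ 2 + (1 + e * z) * w) + (w + 1) * (e * z ^ 3 + z ^ 2 + z) := by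
      linear_combination z ^ 2 * (w + 1) * w ^ 2 * hp + z ^ 2 * (w + 1) * hp2 +
        (w + 1) * (e * z ^ 3 + z ^ 2 + z) * h3
    rw [e1]
    clear e1 h3 hp hp' hp2 hk hz1 hz hN hw hne hne' hz0
    grind
  have hw1 : w + 1 ≠ 0 := fun h => hw (by grind)
  rw [key]
  simp [hz0, hne, hw1]

lemma IsUnitRoot.eq_of_tr_eq_zero {e z y : E} (hz : S.IsUnitRoot e z) (hy : S.IsUnitRoot e y)
    (hN : e * S.conj e ≠ 1) (htr : S.tr (S.invariant e) = 0) : y = z := by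
  by_contra hne
  have h2 := S.tr_invariant hz hN
  have hz0 := S.isUnit_root_ne_zero hz.1
  have hw1 : y / z * S.conj (y / z) = 1 := by
    rw [map_div₀, div_mul_div_comm, hy.1, hz.1, div_one]
  have hq := (S.cofactor_quadratic_iff hz hN (w := y / z) (by rwa [Ne, div_eq_one_iff_eq hz0])).1
    (by rw [mul_div_cancel₀ _ hz0]; exact hy.2)
  generalize y / z = w at *
  generalize cofactor e z = p at *
  have hv : (p * w) ^ 2 + p * w = p * S.conj p := by
    linear_combination p * hq - CharTwo.add_self_eq_zero (p * S.conj p)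
  have htv := S.tr_sq_add_self (p * w)
  rw [hv, ← h2, htr, map_mul] at htv
  have hw0 := S.isUnit_root_ne_zero hw1
  generalize S.conj w = w' at *
  generalize S.conj p = p' at *
  grind

lemma tr_eq_zero_of_unique {e z : E} (hz : S.IsUnitRoot e z)
    (hN : e * S.conj e ≠ 1) (huniq : ∀ y, S.IsUnitRoot e y → y = z) :
    S.tr (S.invariant e) = 0 := by
  by_contra htr
  have h2 := S.tr_invariant hz hN
  have hz0 := S.isUnit_root_ne_zero hz.1
  have hne := S.one_add_mul_ne_zero hz hN
  have hp : cofactor e z * (1 + e * z) = e * z := by rw [cofactor]; field_simp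
  have hp' := congrArg S.conj hp
  have hq := fun w => S.cofactor_quadratic_iff (w := w) hz hN
  obtain ⟨v, hv⟩ := S.exists_sq_add_self _ (S.conj_mul_conj (cofactor e z))
  have hcv : S.conj v = v + 1 := by
    refine (S.conj_eq_or_of_sq_add_self (S.conj_mul_conj _) hv).resolve_left fun h => htr ?_
    rw [h2, ← hv, S.tr_sq_add_of_fixed h]
  have hp0 : cofactor e z ≠ 0 := by
    intro h
    apply htr
    rw [h2, h]; simp
  have hp0' := S.conj_ne_zero hp0
  have hw1 : (v / cofactor e z) * S.conj (v / cofactor e z) = 1 := by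
    rw [map_div₀, hcv]
    field_simp
    linear_combination hv
  have hw2 : cofactor e z * (v / cofactor e z) ^ 2 + v / cofactor e z +
      S.conj (cofactor e z) = 0 := by
    field_simp
    linear_combination hv + CharTwo.add_self_eq_zero (cofactor e z * S.conj (cofactor e z))
  have hw : v / cofactor e z ≠ 1 := by
    intro h
    rw [h] at hw2
    obtain ⟨hz1, hz⟩ := hz
    simp only [map_mul, map_add, map_one] at hp'
    generalize S.conj (cofactor e z) = p' at *
    generalize cofactor e z = p at *
    generalize S.conj e = e' at *
    generalize S.conj z = z' at *
    clear hq huniq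
    have h5 : p' = 1 + p := by grind
    have h6 : (1 + p) * (1 + e * z) = 1 := by grind
    have h7 : p * (1 + e' * z') = 1 := by grind
    have h8 : e * e' = 1 := by grind
    exact hN h8
  refine hw ((mul_eq_left₀ hz0).1 (huniq _ ⟨?_, (hq _ hw).2 hw2⟩))
  rw [map_mul, mul_mul_mul_comm, hz.1, hw1, one_mul]

lemma eq_one_of_unique {e z : E} (hz : S.IsUnitRoot e z)
    (hN : e * S.conj e = 1) (huniq : ∀ y, S.IsUnitRoot e y → y = z) : e = 1 := by
  obtain ⟨hz1, hz⟩ := hz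
  have hz0 := S.isUnit_root_ne_zero hz1
  have hfac : (1 + e * z) * (1 + e * z ^ 2) = 0 := by
    generalize S.conj e = e' at *
    generalize S.conj z = z' at *
    grind
  rcases mul_eq_zero.1 hfac with h | h
  · obtain ⟨y, hy⟩ := S.exists_sq z
    have hy1 : (y * S.conj y) ^ 2 = 1 := by rw [mul_pow, ← map_pow, hy, hz1]
    have hroot : S.IsUnitRoot e y := by
      constructor
      · generalize S.conj y = y' at *
        grind
      · generalize S.conj e = e' at *
        grind
    have := huniq _ hroot
    grind
  · have hroot : S.IsUnitRoot e (z ^ 2) := by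
      constructor
      · rw [map_pow, ← mul_pow, hz1, one_pow]
      · generalize S.conj e = e' at *
        grind
    have := huniq _ hroot
    grind

/-- For every `t` of norm one, the cubic attached to `a t + b t²` is either `(z + 1)³` or has
nonzero discriminant and invariant of trace zero. -/
def Admissible (a b : E) : Prop :=
  ∀ t, t * S.conj t = 1 →
    ((a * t + b * t ^ 2) * S.conj (a * t + b * t ^ 2) = 1 → a * t + b * t ^ 2 = 1) ∧
    ((a * t + b * t ^ 2) * S.conj (a * t + b * t ^ 2) ≠ 1 →
      S.tr (S.invariant (a * t + b * t ^ 2)) = 0)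

omit [CharP E 2] in
lemma one_add_norm_eq {a b t : E} (ht : t * S.conj t = 1) :
    1 + (a * t + b * t ^ 2) * S.conj (a * t + b * t ^ 2) =
      1 + a * S.conj a + b * S.conj b + S.conj a * b * t + a * S.conj b * S.conj t := by
  simp only [map_add, map_mul, map_pow]
  linear_combination (a * S.conj a + a * S.conj b * S.conj t + S.conj a * b * t +
    b * S.conj b * (t * S.conj t + 1)) * ht

lemma eq_one_iff_add_one {x : E} : x = 1 ↔ 1 + x = 0 := by grind

lemma one_add_norm_of_mul_conj {a b t : E} (ha : a ≠ 0) (hb : b * S.conj a = a)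
    (ht : t * S.conj t = 1) :
    1 + (a * t + b * t ^ 2) * S.conj (a * t + b * t ^ 2) =
      S.conj a * S.conj t * (1 + (a * t + b * t ^ 2)) := by
  have hb' : S.conj b * a = S.conj a := by simpa [S.conj_conj] using congrArg S.conj hb
  have ha' := S.conj_ne_zero ha
  rw [S.one_add_norm_eq ht]
  generalize S.conj a = a' at *
  generalize S.conj b = b' at *
  generalize S.conj t = t' at *
  have h1 : b * b' = 1 := by grind
  linear_combination CharTwo.add_self_eq_zero (1 : E) + h1 + t' * hb' - (a * a' + a' * b * t) * ht

lemma invariant_of_mul_conj {a b t : E} (ha : a ≠ 0) (hb : b * S.conj a = a)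
    (ht : t * S.conj t = 1) (hN : (a * t + b * t ^ 2) * S.conj (a * t + b * t ^ 2) ≠ 1) :
    S.invariant (a * t + b * t ^ 2) = 1 + 1 / (a * S.conj a) := by
  have h1 := S.one_add_norm_of_mul_conj ha hb ht
  have ha' := S.conj_ne_zero ha
  have h2 := congrArg S.conj h1
  have hne : 1 + (a * t + b * t ^ 2) * S.conj (a * t + b * t ^ 2) ≠ 0 :=
    fun h => hN (eq_one_iff_add_one.2 h)
  rw [invariant]
  generalize a * t + b * t ^ 2 = e at *
  simp only [map_add, map_mul, map_one, S.conj_conj] at h2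
  have h3 : (1 + e) * (1 + S.conj e) * (a * S.conj a) = (1 + e * S.conj e) ^ 2 := by
    generalize S.conj a = a' at *
    generalize S.conj e = e' at *
    generalize S.conj t = t' at *
    linear_combination (-(1 + e) * (1 + e') * (a * a')) * ht - (1 + e * e') * h1 -
      a' * t' * (1 + e) * h2
  rw [add_comm 1 (1 / _), add_left_inj]
  field_simp
  linear_combination h3

lemma admissible_of_mul_conj {a b : E} (ha : a ≠ 0) (hb : b * S.conj a = a)
    (htr : S.tr (1 + 1 / (a * S.conj a)) = 0) : S.Admissible a b := by
  intro t ht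
  refine ⟨fun hN => ?_, fun hN => by rwa [S.invariant_of_mul_conj ha hb ht hN]⟩
  have h1 := S.one_add_norm_of_mul_conj ha hb ht
  have ht0' := S.conj_ne_zero (S.isUnit_root_ne_zero ht)
  rw [hN, CharTwo.add_self_eq_zero, eq_comm, mul_eq_zero] at h1
  exact eq_one_iff_add_one.2 (h1.resolve_left (mul_ne_zero (S.conj_ne_zero ha) ht0'))

/-- The parameters of the second family: `r ^ 2` and `r + r ^ 2` are the norms of `b` and `a`. -/
lemma exists_param {a b : E} (ha : a ≠ 0)
    (hab : b * (1 + a * S.conj a + b * S.conj b) + a ^ 2 = 0) (hb : b * S.conj b ≠ 1) :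
    ∃ r, S.conj r = r ∧ r ≠ 0 ∧ 1 + r ≠ 0 ∧ b * S.conj b = r ^ 2 ∧ a * S.conj a = r + r ^ 2 ∧
      b * (1 + r) = a ^ 2 := by
  have ha' := S.conj_ne_zero ha
  have hab' := congrArg S.conj hab
  simp only [map_add, map_mul, map_one, S.conj_conj, map_pow, map_zero] at hab'
  have hE0 : 1 + a * S.conj a + b * S.conj b ≠ 0 := by
    intro h
    rw [h] at hab
    simp [ha] at hab
  refine ⟨a * S.conj a / (1 + a * S.conj a + b * S.conj b), ?_, ?_⟩
  · simp only [map_div₀, map_add, map_mul, map_one, S.conj_conj]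
    ring
  · obtain ⟨r, hr⟩ : ∃ r, r = a * S.conj a / (1 + a * S.conj a + b * S.conj b) := ⟨_, rfl⟩
    rw [← hr]
    have hr0 : r ≠ 0 := by rw [hr]; exact div_ne_zero (mul_ne_zero ha ha') hE0
    rw [eq_div_iff hE0] at hr
    generalize S.conj a = a' at *
    generalize S.conj b = b' at *
    have hB : b * b' = r ^ 2 := by
      have : (1 + a * a' + b * b') ^ 2 * (b * b') = (1 + a * a' + b * b') ^ 2 * r ^ 2 := by
        rw [← mul_pow, mul_comm _ r, hr]
        grind
      exact mul_left_cancel₀ (pow_ne_zero 2 hE0) this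
    have hr1 : 1 + r ≠ 0 := by grind
    have hA : a * a' = r + r ^ 2 := by
      have : (1 + r) * (a * a' + (r + r ^ 2)) = 0 := by grind
      have := (mul_eq_zero.1 this).resolve_left hr1
      grind
    refine ⟨hr0, hr1, hB, hA, ?_⟩
    grind

lemma conj_eq_self_of_tr_eq_zero {c v : E} (hv : v ^ 2 + v = c) (hc : S.tr c = 0) :
    S.conj v = v := by
  have := S.tr_sq_add_self v
  rw [hv, hc] at this
  grind

lemma one_add_norm_of_param {a b r t : E} (hr1 : 1 + r ≠ 0)
    (hr : S.conj r = r) (hB : b * S.conj b = r ^ 2) (hA : a * S.conj a = r + r ^ 2)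
    (hab : b * (1 + r) = a ^ 2) (ht : t * S.conj t = 1) :
    1 + (a * t + b * t ^ 2) * S.conj (a * t + b * t ^ 2) =
      1 + r + r * (a * t + S.conj a * S.conj t) := by
  have hab' := congrArg S.conj hab
  simp only [map_add, map_mul, map_one, map_pow, hr] at hab'
  rw [S.one_add_norm_eq ht]
  generalize S.conj a = a' at *
  generalize S.conj b = b' at *
  generalize S.conj t = t' at *
  have h1 : a' * b = a * r := by
    have : (1 + r) * (a' * b) = (1 + r) * (a * r) := by linear_combination a' * hab + a * hA
    exact mul_left_cancel₀ hr1 this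
  have h2 : a * b' = a' * r := by
    have : (1 + r) * (a * b') = (1 + r) * (a' * r) := by linear_combination a * hab' + a' * hA
    exact mul_left_cancel₀ hr1 this
  linear_combination hA + hB + CharTwo.add_self_eq_zero (r ^ 2) + t * h1 + t' * h2

lemma norm_ne_one_of_param {a b r t : E} (hr0 : r ≠ 0) (hr1 : 1 + r ≠ 0)
    (hr : S.conj r = r) (hB : b * S.conj b = r ^ 2) (hA : a * S.conj a = r + r ^ 2)
    (hab : b * (1 + r) = a ^ 2) (htr : S.tr (r / (1 + r)) = 0) (ht : t * S.conj t = 1) :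
    (a * t + b * t ^ 2) * S.conj (a * t + b * t ^ 2) ≠ 1 := by
  intro hN
  have h := S.one_add_norm_of_param hr1 hr hB hA hab ht
  rw [hN, CharTwo.add_self_eq_zero] at h
  have hfix : S.conj (r / (1 + r)) = r / (1 + r) := by
    simp only [map_div₀, map_add, map_one, hr]
  obtain ⟨v, hv⟩ := S.exists_sq_add_self _ hfix
  have hvf := S.conj_eq_self_of_tr_eq_zero hv htr
  rw [eq_div_iff hr1] at hv
  have hx : S.conj (a * t) = S.conj a * S.conj t := map_mul _ _ _
  have hroot : (a * t * r + (1 + r) * (v + r)) * (a * t * r + (1 + r) * (v + r + 1)) = 0 := by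
    have hxx : a * t * (S.conj a * S.conj t) = r + r ^ 2 := by
      rw [mul_mul_mul_comm, hA, ht, mul_one]
    generalize S.conj a * S.conj t = x' at *
    generalize a * t = x at *
    clear hN ht hA hab hB hx hfix htr hvf
    grind
  have hy : S.conj (a * t) * r = a * t * r := by
    rcases mul_eq_zero.1 hroot with h0 | h0
    · have h1 : a * t * r = (1 + r) * (v + r) := by grind
      have := congrArg S.conj h1
      simp only [map_mul _ _ r, map_mul _ _ (v + r), map_add, map_one, hr, hvf] at this
      rw [h1]
      simpa using this
    · have h1 : a * t * r = (1 + r) * (v + r + 1) := by grind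
      have := congrArg S.conj h1
      simp only [map_mul _ _ r, map_add, map_one, map_mul, hr, hvf] at this
      rw [h1]
      simpa using this
  rw [hx] at hy
  grind

lemma invariant_of_param {a b r t : E} (hr1 : 1 + r ≠ 0)
    (hr : S.conj r = r) (hB : b * S.conj b = r ^ 2) (hA : a * S.conj a = r + r ^ 2)
    (hab : b * (1 + r) = a ^ 2) (ht : t * S.conj t = 1)
    (hN : (a * t + b * t ^ 2) * S.conj (a * t + b * t ^ 2) ≠ 1) :
    S.tr (S.invariant (a * t + b * t ^ 2)) = S.tr (r / (1 + r)) := by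
  have h := S.one_add_norm_of_param hr1 hr hB hA hab ht
  have hne : 1 + r + r * (a * t + S.conj a * S.conj t) ≠ 0 := by
    rw [← h]
    exact fun h => hN (eq_one_iff_add_one.2 h)
  have hfix : S.conj ((a * t + S.conj a * S.conj t) / (1 + r + r * (a * t + S.conj a * S.conj t))) =
      (a * t + S.conj a * S.conj t) / (1 + r + r * (a * t + S.conj a * S.conj t)) := by
    simp only [map_div₀, map_add, map_mul, map_one, S.conj_conj, hr]
    rw [add_comm (_ * _) (a * t)]
  have key : S.invariant (a * t + b * t ^ 2) = r / (1 + r) +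
      (((a * t + S.conj a * S.conj t) / (1 + r + r * (a * t + S.conj a * S.conj t))) ^ 2 +
      (a * t + S.conj a * S.conj t) / (1 + r + r * (a * t + S.conj a * S.conj t))) := by
    have hab' := congrArg S.conj hab
    simp only [map_add, map_mul, map_one, map_pow, hr] at hab'
    rw [invariant, h]
    simp only [map_add, map_mul, map_pow] at *
    generalize S.conj a = a' at *
    generalize S.conj b = b' at *
    generalize S.conj t = t' at *
    have h3 : (1 + (a * t + b * t ^ 2)) * (1 + (a' * t' + b' * t' ^ 2)) * (1 + r) =
        (1 + r) ^ 2 * (1 + (a * t + a' * t')) + (a * t + a' * t') ^ 2 := by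
      have hbt : b * t ^ 2 * (1 + r) = (a * t) ^ 2 := by linear_combination t ^ 2 * hab
      have hbt' : b' * t' ^ 2 * (1 + r) = (a' * t') ^ 2 := by linear_combination t' ^ 2 * hab'
      have hxx : a * t * (a' * t') = r + r ^ 2 := by rw [mul_mul_mul_comm, hA, ht, mul_one]
      generalize a * t = x at *
      generalize a' * t' = x' at *
      generalize b * t ^ 2 = y at *
      generalize b' * t' ^ 2 = y' at *
      clear hfix hne hN h hA hB hab hab' ht
      grind
    rw [eq_div_of_mul_eq hr1 h3]
    generalize a * t + a' * t' = T at *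
    field_simp
    clear h3 h hfix hN hab hab' hA hB ht
    grind
  rw [key, map_add, S.tr_sq_add_of_fixed hfix, add_zero]

omit [CharP E 2] in
lemma norm_div_norm_of_param {a b r : E} (hr0 : r ≠ 0) (hr1 : 1 + r ≠ 0)
    (hB : b * S.conj b = r ^ 2) (hA : a * S.conj a = r + r ^ 2) :
    b * S.conj b / (a * S.conj a) = r / (1 + r) := by
  rw [hB, hA, show r + r ^ 2 = r * (1 + r) by ring]
  field_simp

lemma admissible_of_param {a b : E} (ha : a ≠ 0)
    (hab : b * (1 + a * S.conj a + b * S.conj b) + a ^ 2 = 0) (hb : b * S.conj b ≠ 1)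
    (htr : S.tr (b * S.conj b / (a * S.conj a)) = 0) :
    S.Admissible a b ∧
      ∀ t, t * S.conj t = 1 → (a * t + b * t ^ 2) * S.conj (a * t + b * t ^ 2) ≠ 1 := by
  obtain ⟨r, hr, hr0, hr1, hB, hA, hab⟩ := S.exists_param ha hab hb
  rw [S.norm_div_norm_of_param hr0 hr1 hB hA] at htr
  have hN := fun t => S.norm_ne_one_of_param (t := t) hr0 hr1 hr hB hA hab htr
  exact ⟨fun t ht => ⟨fun h => absurd h (hN t ht),
    fun h => (S.invariant_of_param hr1 hr hB hA hab ht h).trans htr⟩, hN⟩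

lemma exists_conj_eq_add_one : ∃ w, S.conj w = w + 1 := by
  obtain ⟨x, hx⟩ : ∃ x, x + S.conj x ≠ 0 := by
    by_contra! h
    exact one_ne_zero (S.eq_zero_of_tr_const 1 0 fun ζ _ => by rw [one_mul, h, map_zero])
  refine ⟨x / (x + S.conj x), ?_⟩
  simp only [map_div₀, map_add, S.conj_conj]
  rw [add_comm (S.conj x) x]
  field_simp
  grind

lemma conj_eq_self_of_sq {y s : E} (hy : y ^ 2 = s) (hs : S.conj s = s) :
    S.conj y = y := by
  have : S.conj y ^ 2 = y ^ 2 := by rw [← map_pow, hy, hs]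
  exact CharTwo.sq_injective this

lemma not_admissible_of_fixed {a b : E} (ha : a ≠ 0) (hb : b ≠ 0) (haf : S.conj a = a)
    (hab : b = 1 + a) : ¬ S.Admissible a b := by
  intro h
  have hbf : S.conj b = b := by rw [hab, map_add, map_one, haf]
  have key : ∀ w, S.conj w = w + 1 → S.tr (1 / (a ^ 2 * b) + 1 + (w ^ 2 + w) / b ^ 2) = 0 := by
    intro w hw
    have hw0 : w ≠ 0 := by rintro rfl; simp at hw
    have hw1 : w + 1 ≠ 0 := hw ▸ S.conj_ne_zero hw0
    have ht' : S.conj ((w + 1) / w) = w / (w + 1) := by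
      rw [map_div₀, map_add, hw, map_one, add_assoc, CharTwo.add_self_eq_zero, add_zero]
    have ht : (w + 1) / w * S.conj ((w + 1) / w) = 1 := by
      rw [ht']
      field_simp
    have h1 := S.one_add_norm_eq (a := a) (b := b) ht
    have h2 : 1 + a * S.conj a + b * S.conj b + S.conj a * b * ((w + 1) / w) +
        a * S.conj b * S.conj ((w + 1) / w) = a * b / (w * (w + 1)) := by
      rw [ht', haf, hbf]
      field_simp
      subst hab
      grind
    rw [h2] at h1
    have hN : (a * ((w + 1) / w) + b * ((w + 1) / w) ^ 2) *
        S.conj (a * ((w + 1) / w) + b * ((w + 1) / w) ^ 2) ≠ 1 := by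
      intro h
      rw [h, CharTwo.add_self_eq_zero] at h1
      exact div_ne_zero (mul_ne_zero ha hb) (mul_ne_zero hw0 hw1) h1.symm
    rw [← (h _ ht).2 hN, invariant, h1]
    congr 1
    simp only [map_add, map_mul, map_pow, haf, hbf, ht']
    field_simp
    subst hab
    grind
  obtain ⟨w, hw⟩ := S.exists_conj_eq_add_one
  have hdiff : ∀ y, S.conj y = y → S.tr ((y ^ 2 + y) / b ^ 2) = 0 := by
    intro y hy
    have h1 := key w hw
    have h2 := key (w + y) (by rw [map_add, hw, hy]; ring)
    have h3 : 1 / (a ^ 2 * b) + 1 + ((w + y) ^ 2 + (w + y)) / b ^ 2 =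
        (1 / (a ^ 2 * b) + 1 + (w ^ 2 + w) / b ^ 2) + (y ^ 2 + y) / b ^ 2 := by
      rw [CharTwo.add_sq]
      ring
    rwa [h3, map_add, h1, zero_add] at h2
  have hδ : 1 / b ^ 2 + 1 / b ^ 4 = 0 := by
    refine S.eq_zero_of_tr_const _ 0 fun ζ _ => ?_
    obtain ⟨y, hy⟩ := S.exists_sq (ζ + S.conj ζ)
    have hyf : S.conj y = y := S.conj_eq_self_of_sq hy (by rw [map_add, S.conj_conj, add_comm])
    have h1 := hdiff y hyf
    rw [add_div, map_add, ← S.tr_sq_of_fixed (x := y / b ^ 2) (by rw [map_div₀, map_pow, hbf, hyf]),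
      ← map_add] at h1
    rw [← h1]
    congr 1
    simp only [map_add, map_mul, map_div₀, map_pow, hbf, map_one]
    field_simp
    rw [hy]
  have : b = 1 := by
    field_simp at hδ
    have : (b + 1) ^ 2 = 0 := by rw [CharTwo.add_sq]; linear_combination hδ
    have := pow_eq_zero_iff two_ne_zero |>.1 this
    grind
  grind

lemma Admissible.discriminant_ne_zero {a b : E} (ha : a ≠ 0) (hb : b ≠ 0)
    (h : S.Admissible a b) : 1 + a * S.conj a + b * S.conj b ≠ 0 := by
  intro hE
  have ha' := S.conj_ne_zero ha
  have hb' := S.conj_ne_zero hb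
  obtain ⟨s, hs⟩ := S.exists_sq (a * S.conj b / (S.conj a * b))
  have hs1 : s * S.conj s = 1 := by
    have : (s * S.conj s) ^ 2 = 1 ^ 2 := by
      rw [mul_pow, ← map_pow, hs]
      simp only [map_div₀, map_mul, S.conj_conj]
      field_simp
    exact CharTwo.sq_injective this
  have hN := S.one_add_norm_eq (a := a) (b := b) hs1
  have hs2 : S.conj a * b * s = a * S.conj b * S.conj s := by
    rw [eq_div_iff (mul_ne_zero ha' hb)] at hs
    linear_combination S.conj s * hs - S.conj a * b * s * hs1
  rw [hE, zero_add, hs2, CharTwo.add_self_eq_zero] at hN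
  have he := (h s hs1).1 (eq_one_iff_add_one.2 hN)
  have hs0 := S.isUnit_root_ne_zero hs1
  refine S.not_admissible_of_fixed (a := a * s) (b := b * s ^ 2) (mul_ne_zero ha hs0)
    (mul_ne_zero hb (pow_ne_zero 2 hs0)) ?_ (by grind) fun t ht => ?_
  · have he' := congrArg S.conj he
    simp only [map_add, map_mul, map_one, map_pow] at he' ⊢
    generalize S.conj a = a' at *
    generalize S.conj b = b' at *
    generalize S.conj s = s' at *
    have h1 : b * s ^ 2 = 1 + a * s := by grind
    have h2 : a' * s' * (b * s ^ 2) = a * s * (b' * s' ^ 2) := by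
      linear_combination s' * s * hs2
    have h3 : b' * s' ^ 2 = 1 + a' * s' := by grind
    rw [h1, h3] at h2
    linear_combination h2
  · have := h (s * t) (by rw [map_mul, mul_mul_mul_comm, hs1, ht, one_mul])
    rwa [show a * s * t + b * s ^ 2 * t ^ 2 = a * (s * t) + b * (s * t) ^ 2 by ring]

lemma exists_norm_ne_one {a b : E} (hE : 1 + a * S.conj a + b * S.conj b ≠ 0) :
    ∃ t, t * S.conj t = 1 ∧ (a * t + b * t ^ 2) * S.conj (a * t + b * t ^ 2) ≠ 1 := by
  by_contra! h
  obtain ⟨w, hw⟩ := S.exists_conj_eq_add_one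
  have hw0 : w ≠ 0 := by rintro rfl; simp at hw
  have hw1 : w + 1 ≠ 0 := hw ▸ S.conj_ne_zero hw0
  have hc : S.conj ((w + 1) / w) = w / (w + 1) := by
    rw [map_div₀, map_add, hw, map_one, add_assoc, CharTwo.add_self_eq_zero, add_zero]
  have hc' : S.conj (w / (w + 1)) = (w + 1) / w := by
    rw [← hc, S.conj_conj]
  have hm : (w + 1) / w * (w / (w + 1)) = 1 := by field_simp
  have key : ∀ t, t * S.conj t = 1 → 1 + a * S.conj a + b * S.conj b + S.conj a * b * t +
      a * S.conj b * S.conj t = 0 := fun t ht => by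
    rw [← S.one_add_norm_eq ht, h t ht, CharTwo.add_self_eq_zero]
  have h1 := key 1 (by simp)
  have h2 := key ((w + 1) / w) (by rw [hc, hm])
  have h3 := key (w / (w + 1)) (by rw [hc', mul_comm, hm])
  rw [hc] at h2
  rw [hc'] at h3
  rw [map_one] at h1
  have h4 : (1 + a * S.conj a + b * S.conj b) * ((w + 1) / w + w / (w + 1)) = 0 := by
    generalize (w + 1) / w = t at *
    generalize w / (w + 1) = t' at *
    clear key
    grind
  have h5 := (mul_eq_zero.1 h4).resolve_left hE
  field_simp at h5
  grind

lemma tr_eq_zero_of_mul_conj {a b : E} (ha : a ≠ 0) (hb : b * S.conj a = a)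
    (hE : 1 + a * S.conj a + b * S.conj b ≠ 0) (h : S.Admissible a b) :
    S.tr (1 + 1 / (a * S.conj a)) = 0 := by
  obtain ⟨t, ht, hN⟩ := S.exists_norm_ne_one hE
  rw [← S.invariant_of_mul_conj ha hb ht hN]
  exact (h t ht).2 hN

lemma sq_eq_of_tr_const {p q r c : E} (hr : r ≠ 0)
    (h : ∀ ζ, ζ * S.conj ζ = 1 →
      S.tr (p * (r * ζ) + q * (r * ζ) ^ 2 + S.conj (p * (r * ζ) + q * (r * ζ) ^ 2)) = c) :
    p ^ 2 = q := by
  have h0 : (p ^ 2 + q) * r ^ 2 = 0 := by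
    refine S.eq_zero_of_tr_const _ c fun η hη => ?_
    obtain ⟨ζ, rfl⟩ := S.exists_sq η
    have hζ : ζ * S.conj ζ = 1 := by
      apply CharTwo.sq_injective
      simpa [mul_pow] using hη
    have hfix : S.conj (p * (r * ζ) + S.conj (p * (r * ζ))) =
        p * (r * ζ) + S.conj (p * (r * ζ)) := by
      rw [map_add, S.conj_conj, add_comm]
    rw [← h ζ hζ, show p * (r * ζ) + q * (r * ζ) ^ 2 + S.conj (p * (r * ζ) + q * (r * ζ) ^ 2) =
        (p * (r * ζ) + S.conj (p * (r * ζ))) + (q * (r * ζ) ^ 2 + S.conj (q * (r * ζ) ^ 2)) by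
      rw [map_add]; ring, map_add S.tr (p * (r * ζ) + S.conj (p * (r * ζ))),
      ← S.tr_sq_of_fixed hfix, ← map_add]
    congr 1
    rw [CharTwo.add_sq, ← map_pow]
    simp only [map_add, map_mul, map_pow]
    ring
  have := (mul_eq_zero.1 h0).resolve_right (pow_ne_zero 2 hr)
  grind

lemma norm_ne_one_of_fixed_split {a b s₁ s₂ t : E}
    (hd0 : 1 + a * S.conj a + b * S.conj b ≠ 0) (hs₁ : S.conj s₁ = s₁) (hs₂ : S.conj s₂ = s₂)
    (hsum : s₁ + s₂ = 1 + a * S.conj a + b * S.conj b)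
    (hprod : s₁ * s₂ = a * S.conj a * (b * S.conj b)) (ht : t * S.conj t = 1) :
    (a * t + b * t ^ 2) * S.conj (a * t + b * t ^ 2) ≠ 1 := by
  intro hN
  have h1 := S.one_add_norm_eq (a := a) (b := b) ht
  rw [hN, CharTwo.add_self_eq_zero] at h1
  have h2 : (S.conj a * b * t + s₁) * (S.conj a * b * t + s₂) = 0 := by
    linear_combination (-(S.conj a * b * t)) * h1 + S.conj a * b * t * hsum + hprod +
      a * S.conj a * b * S.conj b * (-ht)
  have h3 : S.conj (S.conj a * b * t) = S.conj a * b * t := by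
    rcases mul_eq_zero.1 h2 with h | h
    · rw [CharTwo.add_eq_zero.1 h, hs₁]
    · rw [CharTwo.add_eq_zero.1 h, hs₂]
  apply hd0
  simp only [map_mul, S.conj_conj] at h3
  linear_combination (-1) * h1 - h3 - S.conj a * b * t * CharTwo.two_eq_zero (R := E)

lemma tr_of_param {a b s₁ s₂ τ : E} (ha : a ≠ 0) (hb : b ≠ 0)
    (hd0 : 1 + a * S.conj a + b * S.conj b ≠ 0) (hs₁ : S.conj s₁ = s₁) (hs₂ : S.conj s₂ = s₂)
    (hs₁0 : s₁ ≠ 0) (hs₂0 : s₂ ≠ 0)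
    (hsum : s₁ + s₂ = 1 + a * S.conj a + b * S.conj b)
    (hprod : s₁ * s₂ = a * S.conj a * (b * S.conj b)) (h : S.Admissible a b)
    (hτ : s₂ * (τ * S.conj τ) = s₁) (g Q : E) (hg : g = S.conj a * b)
    (hQ : Q = g ^ 2 + a * g * s₁ + b * s₁ ^ 2 + a * g * (s₁ + s₂) * τ +
      (g ^ 2 + a * g * s₂ + b * s₂ ^ 2) * τ ^ 2) :
    S.tr (Q * S.conj Q / (s₁ ^ 2 * (s₁ + s₂) ^ 4)) = S.tr 1 := by
  have hτ1 : 1 + τ ≠ 0 := by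
    intro h1
    have : τ = 1 := by grind
    rw [this, map_one] at hτ
    apply hd0
    rw [← hsum]; grind
  have hτ1' := S.conj_ne_zero hτ1
  have hg0 : g ≠ 0 := hg ▸ mul_ne_zero (S.conj_ne_zero ha) hb
  have hg0' := S.conj_ne_zero hg0
  have hgg : g * S.conj g = s₁ * s₂ := by rw [hprod, hg, map_mul, S.conj_conj]; ring
  rw [map_add, map_one] at hτ1'
  obtain ⟨t, htdef⟩ : ∃ t, t = (s₁ + s₂ * τ) / (g * (1 + τ)) := ⟨_, rfl⟩
  have htdef' : S.conj t = (s₁ + s₂ * S.conj τ) / (S.conj g * (1 + S.conj τ)) := by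
    simp [htdef, hs₁, hs₂]
  have ht : t * S.conj t = 1 := by
    rw [htdef', htdef]
    field_simp
    linear_combination (s₂ - s₁) * hτ - (1 + τ) * (1 + S.conj τ) * hgg
  have hN := S.norm_ne_one_of_fixed_split hd0 hs₁ hs₂ hsum hprod ht
  have htr := (h t ht).2 hN
  rw [invariant, map_add] at htr
  have h1N : 1 + (a * t + b * t ^ 2) * S.conj (a * t + b * t ^ 2) =
      (s₁ + s₂) ^ 2 / (s₂ * ((1 + τ) * (1 + S.conj τ))) := by
    rw [S.one_add_norm_eq ht, ← hsum, ← hg, show a * S.conj b = S.conj g by simp [hg, S.conj_conj],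
      htdef', htdef]
    field_simp
    generalize S.conj τ = τ' at *
    clear htdef' ht hN hτ1' hprod hsum htr
    grind
  have he : 1 + (a * t + b * t ^ 2) = Q / (g ^ 2 * (1 + τ) ^ 2) := by
    rw [htdef, hQ]
    field_simp
    generalize S.conj τ = τ' at *
    clear hτ hprod hsum
    grind
  have he' : 1 + S.conj (a * t + b * t ^ 2) =
      S.conj Q / (S.conj g ^ 2 * (1 + S.conj τ) ^ 2) := by
    simpa using congrArg S.conj he
  have key : Q * S.conj Q / (s₁ ^ 2 * (s₁ + s₂) ^ 4) =
      (1 + (a * t + b * t ^ 2)) * (1 + S.conj (a * t + b * t ^ 2)) /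
      (1 + (a * t + b * t ^ 2) * S.conj (a * t + b * t ^ 2)) ^ 2 := by
    have hs : s₁ + s₂ ≠ 0 := hsum ▸ hd0
    rw [h1N, he, he']
    field_simp
    linear_combination Q * S.conj Q * (g * S.conj g + s₁ * s₂) * hgg
  rw [key]
  exact CharTwo.add_eq_zero.1 htr

lemma eq_or_of_square_identities {g g' A B d s₁ s₂ : E} (hA : A ≠ 0) (hB : B ≠ 0)
    (hd0 : d ≠ 0) (hd : d = 1 + A + B) (hg : g * g' = A ^ 2 * B) (hsum : s₁ + s₂ = d)
    (hprod : s₁ * s₂ = A * B)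
    (h : ((g' + A * B) * s₂ + (g + A * B) * s₁) ^ 2 =
      B * d ^ 2 * ((g + A * B + (1 + B) * s₂) * (g' + A * B + (1 + B) * s₁)))
    (h' : ((g + A * B) * s₂ + (g' + A * B) * s₁) ^ 2 =
      B * d ^ 2 * ((g' + A * B + (1 + B) * s₂) * (g + A * B + (1 + B) * s₁))) :
    g = A ∨ g * d = A ^ 2 := by
  obtain ⟨k, hk⟩ : ∃ k, k = g + A * B := ⟨_, rfl⟩
  obtain ⟨k', hk'⟩ : ∃ k', k' = g' + A * B := ⟨_, rfl⟩
  rw [← hk, ← hk'] at h h'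
  have hs1 : s₁ = d + s₂ := by grind
  subst hs1
  have h2 : (2 : E) = 0 := CharTwo.two_eq_zero
  have hkk : k * k' = A ^ 2 * B * (1 + B) + A * B * (k + k') := by
    rw [hk, hk']
    linear_combination hg - (A ^ 2 * B ^ 2) * h2
  have hW : (k' * s₂ + k * (d + s₂)) ^ 2 =
      B * d ^ 2 * (k * k' + (1 + B) * (k' * s₂ + k * (d + s₂)) + (1 + B) ^ 2 * (A * B)) := by
    rw [h, ← hprod]; ring
  have hW' : (k * s₂ + k' * (d + s₂)) ^ 2 =
      B * d ^ 2 * (k * k' + (1 + B) * (k * s₂ + k' * (d + s₂)) + (1 + B) ^ 2 * (A * B)) := by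
    rw [h', ← hprod]; ring
  by_cases hP : k + k' = 0
  · have hkk' : k' = k := by grind
    subst hkk'
    have h3 : d ^ 2 * ((1 + B) * (B * (g * d + A ^ 2))) = 0 := by
      clear h h' hW' hprod hP
      grind
    have h4 := (mul_eq_zero.1 h3).resolve_left (pow_ne_zero 2 hd0)
    rcases mul_eq_zero.1 h4 with h5 | h5
    · left
      have : g ^ 2 = A ^ 2 := by grind
      exact CharTwo.sq_injective this
    · right
      have := (mul_eq_zero.1 h5).resolve_left hB
      grind
  · exfalso
    have h3 : d ^ 2 * ((k + k') * (k + k' + B * d * (1 + B))) = 0 := by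
      clear h h' hk hk' hkk hg hprod hd
      grind
    have h4 := (mul_eq_zero.1 ((mul_eq_zero.1 h3).resolve_left (pow_ne_zero 2 hd0))).resolve_left hP
    have hB1 : 1 + B ≠ 0 := fun h => hP (by linear_combination h4 - B * d * h)
    have hk'' : k' = k + B * d * (1 + B) := by grind
    have h5 : d ^ 2 * ((1 + B) * (k * k' + B * (1 + B) ^ 2 * (A * B))) = 0 := by
      clear h h' hk hk' hkk hg hd h3 h4 hW'
      subst hk''
      grind
    have h6 : k * k' + B * (1 + B) ^ 2 * (A * B) = 0 :=
      (mul_eq_zero.1 ((mul_eq_zero.1 h5).resolve_left (pow_ne_zero 2 hd0))).resolve_left hB1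
    have h7 : A * B * (1 + B) * (A * (1 + B)) = 0 := by
      clear h h' hk hk' hg h3 hW' hW hprod h5
      grind
    exact mul_ne_zero (mul_ne_zero (mul_ne_zero hA hB) hB1) (mul_ne_zero hA hB1) h7

lemma Admissible.mul_conj_eq_of_conj_eq_add_one {a b d v : E} (ha : a ≠ 0) (hb : b ≠ 0)
    (hd0 : d ≠ 0) (hd : d = 1 + a * S.conj a + b * S.conj b) (h : S.Admissible a b)
    (hv : d ^ 2 * (v ^ 2 + v) = a * S.conj a * (b * S.conj b)) (hv' : S.conj v = v + 1) :
    b * S.conj a = a := by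
  have ha' := S.conj_ne_zero ha
  have hb' := S.conj_ne_zero hb
  have hd' : S.conj d = d := by
    rw [hd]
    simp only [map_add, map_mul, map_one, S.conj_conj]
    ring
  have key : ∀ w, d ^ 2 * (w ^ 2 + w) = a * S.conj a * (b * S.conj b) → S.conj w = w + 1 →
      a * (d * w / (S.conj a * b)) + b * (d * w / (S.conj a * b)) ^ 2 = 1 := by
    intro w hw hw'
    have ht : d * w / (S.conj a * b) * S.conj (d * w / (S.conj a * b)) = 1 := by
      simp only [map_div₀, map_mul, S.conj_conj, hw', hd']
      field_simp
      linear_combination hw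
    refine (h _ ht).1 (eq_one_iff_add_one.2 ?_)
    rw [S.one_add_norm_eq ht, ← hd]
    simp only [map_div₀, map_mul, S.conj_conj, hw', hd']
    field_simp
    linear_combination (d * w + d) * CharTwo.two_eq_zero (R := E)
  have h1 := key v hv hv'
  have h2 := key (v + 1) (by rw [← hv, CharTwo.add_sq]; grind)
    (by rw [map_add, hv', map_one])
  generalize S.conj a = a' at *
  generalize S.conj b = b' at *
  field_simp at h1 h2
  have h3 : d * (a * a' + d) = 0 := by
    clear key h hv hd hd' hv'
    grind
  have h4 : a * a' = d := by
    have := (mul_eq_zero.1 h3).resolve_left hd0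
    grind
  clear key h h2 h3
  have h5 : b * b' = 1 := by grind
  rw [h5] at hv
  subst h4
  have h6 : a' * (a + b * a') = 0 := by
    clear hd hd' hv' h5
    grind
  have := (mul_eq_zero.1 h6).resolve_left ha'
  grind

lemma square_identity_of_param {a b s₁ s₂ : E} (ha : a ≠ 0) (hb : b ≠ 0)
    (hd0 : 1 + a * S.conj a + b * S.conj b ≠ 0) (hs₁ : S.conj s₁ = s₁) (hs₂ : S.conj s₂ = s₂)
    (hs₁0 : s₁ ≠ 0) (hs₂0 : s₂ ≠ 0)
    (hsum : s₁ + s₂ = 1 + a * S.conj a + b * S.conj b)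
    (hprod : s₁ * s₂ = a * S.conj a * (b * S.conj b)) (h : S.Admissible a b)
    {g q₀ q₁ q₂ : E} (hg : g = S.conj a * b) (hq₀ : q₀ = g ^ 2 + a * g * s₁ + b * s₁ ^ 2)
    (hq₁ : q₁ = a * g * (s₁ + s₂)) (hq₂ : q₂ = g ^ 2 + a * g * s₂ + b * s₂ ^ 2) :
    (q₁ * S.conj q₀ * s₂ + q₂ * S.conj q₁ * s₁) ^ 2 =
      (s₁ * s₂) ^ 2 * (s₁ + s₂) ^ 4 * (q₂ * S.conj q₀) := by
  have hs : s₁ + s₂ ≠ 0 := hsum ▸ hd0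
  have hgg : g * S.conj g = s₁ * s₂ := by rw [hprod, hg, map_mul, S.conj_conj]; ring
  have hgs : ∀ s, S.conj s = s → (s = s₁ ∨ s = s₂) → g + s ≠ 0 := by
    intro s hsf hss hgs
    have : g = s := CharTwo.add_eq_zero.1 hgs
    rw [this, hsf] at hgg
    apply hs
    rcases hss with rfl | rfl
    · rw [mul_left_cancel₀ hs₁0 hgg, CharTwo.add_self_eq_zero]
    · rw [mul_right_cancel₀ hs₂0 hgg, CharTwo.add_self_eq_zero]
  have hgs₁ := hgs s₁ hs₁ (.inl rfl)
  have hgs₂ := hgs s₂ hs₂ (.inr rfl)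
  obtain ⟨τ, hτdef⟩ : ∃ τ, τ = (g + s₁) / (g + s₂) := ⟨_, rfl⟩
  have hτ0 : τ ≠ 0 := hτdef ▸ div_ne_zero hgs₁ hgs₂
  have hτ : s₂ * (τ * S.conj τ) = s₁ := by
    have h' := S.conj_ne_zero hgs₂
    rw [hτdef, map_div₀]
    simp only [map_add, hs₁, hs₂] at h' ⊢
    field_simp
    linear_combination (s₂ - s₁) * hgg
  obtain ⟨X, hX⟩ : ∃ X, X = 1 / (s₁ ^ 2 * (s₁ + s₂) ^ 4) := ⟨_, rfl⟩
  have hX' : S.conj X = X := by simp [hX, hs₁, hs₂]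
  have key := S.sq_eq_of_tr_const (p := X * (q₁ * S.conj q₀ + q₂ * S.conj q₁ * (s₁ / s₂)))
    (q := X * (q₂ * S.conj q₀)) (r := τ)
    (c := S.tr 1 + S.tr (X * (q₀ * S.conj q₀ + q₁ * S.conj q₁ * (s₁ / s₂) +
      q₂ * S.conj q₂ * (s₁ / s₂) ^ 2))) hτ0 fun ζ hζ => by
    have hσ : s₂ * (τ * ζ * S.conj (τ * ζ)) = s₁ := by
      rw [map_mul]
      linear_combination hτ + s₂ * τ * S.conj τ * hζ
    rw [← S.tr_of_param ha hb hd0 hs₁ hs₂ hs₁0 hs₂0 hsum hprod h hσ g _ hg rfl, ← map_add,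
      ← hq₀, ← hq₁, ← hq₂]
    generalize τ * ζ = σ at hσ
    congr 1
    have hρ : s₁ / s₂ = σ * S.conj σ := by rw [← hσ]; field_simp
    rw [div_eq_mul_one_div _ (s₁ ^ 2 * (s₁ + s₂) ^ 4), ← hX, hρ]
    simp only [map_add, map_mul, map_pow, S.conj_conj, hX']
    clear * -
    generalize S.conj σ = σ' at *
    generalize S.conj q₀ = q₀' at *
    generalize S.conj q₁ = q₁' at *
    generalize S.conj q₂ = q₂' at *
    grind
  rw [hX] at key
  field_simp at key
  linear_combination key

lemma Admissible.mul_eq_or_of_fixed_split {a b s₁ s₂ : E} (ha : a ≠ 0) (hb : b ≠ 0)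
    (hd0 : 1 + a * S.conj a + b * S.conj b ≠ 0) (hs₁ : S.conj s₁ = s₁) (hs₂ : S.conj s₂ = s₂)
    (hsum : s₁ + s₂ = 1 + a * S.conj a + b * S.conj b)
    (hprod : s₁ * s₂ = a * S.conj a * (b * S.conj b)) (h : S.Admissible a b) :
    b * S.conj a = a ∨ b * (1 + a * S.conj a + b * S.conj b) + a ^ 2 = 0 := by
  have ha' := S.conj_ne_zero ha
  have hb' := S.conj_ne_zero hb
  have hA : a * S.conj a ≠ 0 := mul_ne_zero ha ha'
  have hB : b * S.conj b ≠ 0 := mul_ne_zero hb hb'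
  have hC := hprod ▸ mul_ne_zero hA hB
  have hq : ∀ s, s ^ 2 = s * (s₁ + s₂) + s₁ * s₂ → b * (S.conj a ^ 2 * b +
      a * S.conj a * (b * S.conj b) + (1 + b * S.conj b) * s) =
      (S.conj a * b) ^ 2 + a * (S.conj a * b) * s + b * s ^ 2 := by
    intro s hs
    rw [hs, hsum, hprod]
    linear_combination (-(a * S.conj a * b * s)) * CharTwo.two_eq_zero (R := E)
  have hW := S.square_identity_of_param ha hb hd0 hs₁ hs₂ (left_ne_zero_of_mul hC)
    (right_ne_zero_of_mul hC) hsum hprod h rfl (hq s₁ (by grind)) rfl (hq s₂ (by grind))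
  have h1 : ((a ^ 2 * S.conj b + a * S.conj a * (b * S.conj b)) * s₂ +
      (S.conj a ^ 2 * b + a * S.conj a * (b * S.conj b)) * s₁) ^ 2 =
      b * S.conj b * (s₁ + s₂) ^ 2 *
        ((S.conj a ^ 2 * b + a * S.conj a * (b * S.conj b) + (1 + b * S.conj b) * s₂) *
        (a ^ 2 * S.conj b + a * S.conj a * (b * S.conj b) + (1 + b * S.conj b) * s₁)) := by
    apply mul_left_cancel₀ (pow_ne_zero 2 (mul_ne_zero hC (hsum ▸ hd0)))
    simp only [map_add, map_mul, map_pow, S.conj_conj, hs₁, hs₂, map_one] at hW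
    rw [hprod] at hW ⊢
    generalize S.conj a = a' at *
    generalize S.conj b = b' at *
    clear * - hW
    grind
  have h2 := congrArg S.conj h1
  simp only [map_add, map_mul, map_pow, S.conj_conj, hs₁, hs₂, map_one] at h2
  rw [mul_comm (S.conj a) a, mul_comm (S.conj b) b] at h2
  rcases eq_or_of_square_identities hA hB (hsum ▸ hd0) hsum (by ring) rfl hprod h1 h2 with h3 | h3
  · left
    apply mul_left_cancel₀ ha'
    linear_combination h3
  · right
    rw [hsum] at h3
    have : b * (1 + a * S.conj a + b * S.conj b) = a ^ 2 := by
      apply mul_left_cancel₀ (pow_ne_zero 2 ha')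
      linear_combination h3
    rw [this, CharTwo.add_self_eq_zero]

theorem Admissible.cases {a b : E} (ha : a ≠ 0) (hb : b ≠ 0) (h : S.Admissible a b) :
    (b * S.conj a = a ∧ S.tr (1 + 1 / (a * S.conj a)) = 0) ∨
      (b * (1 + a * S.conj a + b * S.conj b) + a ^ 2 = 0 ∧ b * S.conj b ≠ 1 ∧
        S.tr (b * S.conj b / (a * S.conj a)) = 0) := by
  have hd0 := h.discriminant_ne_zero S ha hb
  obtain ⟨d, hd⟩ : ∃ d, d = 1 + a * S.conj a + b * S.conj b := ⟨_, rfl⟩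
  have hd' : S.conj d = d := by
    rw [hd]
    simp only [map_add, map_mul, map_one, S.conj_conj]
    ring
  rw [← hd] at hd0
  have hcase : b * S.conj a = a ∨ b * d + a ^ 2 = 0 := by
    have hfix : S.conj (a * S.conj a * (b * S.conj b) / d ^ 2) =
        a * S.conj a * (b * S.conj b) / d ^ 2 := by
      simp only [map_div₀, map_mul, map_pow, S.conj_conj, hd']
      ring
    obtain ⟨v, hv⟩ := S.exists_sq_add_self _ hfix
    have hv1 : d ^ 2 * (v ^ 2 + v) = a * S.conj a * (b * S.conj b) := by
      rw [hv]; field_simp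
    rcases S.conj_eq_or_of_sq_add_self hfix hv with hvf | hvf
    · rw [hd]
      refine h.mul_eq_or_of_fixed_split S ha hb (hd ▸ hd0) (s₁ := d * v)
        (s₂ := d * (v + 1)) ?_ ?_ ?_ ?_
      · rw [map_mul, hd', hvf]
      · rw [map_mul, map_add, map_one, hd', hvf]
      · rw [← hd]
        linear_combination d * v * CharTwo.two_eq_zero (R := E)
      · linear_combination hv1
    · exact .inl (h.mul_conj_eq_of_conj_eq_add_one S ha hb hd0 hd hv1 hvf)
  have hleft : b * S.conj a = a → S.tr (1 + 1 / (a * S.conj a)) = 0 :=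
    fun h1 => S.tr_eq_zero_of_mul_conj ha h1 (hd ▸ hd0) h
  rcases hcase with h1 | h1
  · exact .inl ⟨h1, hleft h1⟩
  by_cases hb1 : b * S.conj b = 1
  · left
    have : b * S.conj a = a := by
      rw [hb1] at hd
      apply mul_left_cancel₀ ha
      rw [hd] at h1
      linear_combination h1 - (b + a ^ 2) * CharTwo.two_eq_zero (R := E)
    exact ⟨this, hleft this⟩
  · right
    rw [hd] at h1
    refine ⟨h1, hb1, ?_⟩
    obtain ⟨r, hr, hr0, hr1, hB, hA, hab⟩ := S.exists_param ha h1 hb1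
    obtain ⟨t, ht, hN⟩ := S.exists_norm_ne_one (hd ▸ hd0)
    rw [S.norm_div_norm_of_param hr0 hr1 hB hA, ← S.invariant_of_param hr1 hr hB hA hab ht hN]
    exact (h t ht).2 hN

/-- The map `x + conj a * x² / conj x + b * (conj x)² / x`, with value `0` at `0`. -/
def twist (a b x : E) : E := x + S.conj a * (x ^ 2 / S.conj x) + b * (S.conj x ^ 2 / x)

omit [CharP E 2] in
lemma twist_mul {l : E} (a b x : E) (hl : S.conj l = l) :
    S.twist a b (l * x) = l * S.twist a b x := by
  rcases eq_or_ne l 0 with rfl | hl0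
  · simp [twist]
  rw [twist, twist, map_mul, hl, mul_pow, mul_pow, pow_two l, mul_assoc, mul_assoc,
    mul_div_mul_left _ _ hl0, mul_div_mul_left _ _ hl0]
  ring

lemma isUnitRoot_iff {a b x t : E} (hx : x ≠ 0) (ht : t * S.conj t = 1) :
    S.IsUnitRoot (a * t + b * t ^ 2) (S.conj x / (x * t)) ↔
      S.conj (S.twist a b x) = t * S.twist a b x := by
  have hx' := S.conj_ne_zero hx
  have ht0 := S.isUnit_root_ne_zero ht
  have ht0' := S.conj_ne_zero ht0
  have hu : S.conj x / (x * t) * S.conj (S.conj x / (x * t)) = 1 := by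
    simp only [map_div₀, map_mul, S.conj_conj]
    field_simp
    exact ht.symm
  have key : (a * t + b * t ^ 2) * (S.conj x / (x * t)) ^ 3 + (S.conj x / (x * t)) ^ 2 +
      S.conj x / (x * t) + S.conj (a * t + b * t ^ 2) =
      S.conj x / (x ^ 2 * t ^ 2) * (S.conj (S.twist a b x) + t * S.twist a b x) := by
    have ht' : S.conj t = 1 / t := by rw [eq_div_iff ht0, mul_comm, ht]
    simp only [twist, map_add, map_mul, map_div₀, map_pow, S.conj_conj, ht']
    field_simp
    ring
  rw [IsUnitRoot, key, and_iff_right hu, mul_eq_zero, CharTwo.add_eq_zero]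
  refine or_iff_right (div_ne_zero hx' (mul_ne_zero (pow_ne_zero 2 hx) (pow_ne_zero 2 ht0)))

lemma exists_conj_eq_mul {t : E} (ht : t * S.conj t = 1) : ∃ s ≠ 0, S.conj s = t * s := by
  by_cases h : 1 + S.conj t = 0
  · refine ⟨1, one_ne_zero, ?_⟩
    rw [← CharTwo.add_eq_zero.1 h] at ht
    rw [map_one, ht]
  · refine ⟨1 + S.conj t, h, ?_⟩
    rw [map_add, map_one, S.conj_conj]
    linear_combination -ht

lemma exists_eq_conj_div {z t : E} (hz : z * S.conj z = 1) (ht : t * S.conj t = 1) :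
    ∃ x ≠ 0, z = S.conj x / (x * t) := by
  obtain ⟨x, hx, h⟩ := S.exists_conj_eq_mul (t := z * t) (by
    rw [map_mul, mul_mul_mul_comm, hz, ht, one_mul])
  have ht0 := S.isUnit_root_ne_zero ht
  exact ⟨x, hx, by rw [h]; field_simp⟩

omit [CharP E 2] in
lemma twist_zero (a b : E) : S.twist a b 0 = 0 := by simp [twist]

theorem admissible_of_bijective {a b : E} (h : Function.Bijective (S.twist a b)) :
    S.Admissible a b := by
  have hne : ∀ x, x ≠ 0 → S.twist a b x ≠ 0 := fun x hx h0 =>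
    hx (h.1 (h0.trans (S.twist_zero a b).symm))
  intro t ht
  have ht0 := S.isUnit_root_ne_zero ht
  obtain ⟨s, hs0, hs⟩ := S.exists_conj_eq_mul ht
  obtain ⟨x, rfl⟩ := h.2 s
  have hx : x ≠ 0 := by
    rintro rfl
    exact hs0 (S.twist_zero a b)
  have hz := (S.isUnitRoot_iff hx ht).2 hs
  have huniq : ∀ y, S.IsUnitRoot (a * t + b * t ^ 2) y → y = S.conj x / (x * t) := by
    intro y hy
    obtain ⟨w, hw, rfl⟩ := S.exists_eq_conj_div hy.1 ht
    have hwt := (S.isUnitRoot_iff hw ht).1 hy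
    have hl : S.conj (S.twist a b w / S.twist a b x) = S.twist a b w / S.twist a b x := by
      rw [map_div₀, hs, hwt, mul_div_mul_left _ _ ht0]
    have hwx : w = S.twist a b w / S.twist a b x * x := by
      apply h.1
      rw [S.twist_mul _ _ _ hl, div_mul_cancel₀ _ hs0]
    have hl0 := div_ne_zero (hne w hw) hs0
    generalize S.twist a b w / S.twist a b x = l at *
    rw [hwx, map_mul, hl, mul_assoc, mul_div_mul_left _ _ hl0]
  exact ⟨fun hN => S.eq_one_of_unique hz hN huniq, fun hN => S.tr_eq_zero_of_unique hz hN huniq⟩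

lemma Admissible.isUnitRoot_unique {a b t y z : E} (h : S.Admissible a b) (ht : t * S.conj t = 1)
    (hy : S.IsUnitRoot (a * t + b * t ^ 2) y) (hz : S.IsUnitRoot (a * t + b * t ^ 2) z) :
    y = z := by
  by_cases hN : (a * t + b * t ^ 2) * S.conj (a * t + b * t ^ 2) = 1
  · have he := (h t ht).1 hN
    have key : ∀ w, S.IsUnitRoot 1 w → w = 1 := by
      intro w hw
      have h1 := hw.2
      rw [map_one] at h1
      have : (w + 1) ^ 3 = 0 := by
        linear_combination h1 + (w ^ 2 + w) * CharTwo.two_eq_zero (R := E)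
      exact CharTwo.add_eq_zero.1 (pow_eq_zero_iff three_ne_zero |>.1 this)
    rw [he] at hy hz
    rw [key y hy, key z hz]
  · exact IsUnitRoot.eq_of_tr_eq_zero S hz hy hN ((h t ht).2 hN)

theorem Admissible.injective {a b : E} (h : S.Admissible a b)
    (hne : ∀ x, x ≠ 0 → S.twist a b x ≠ 0) : Function.Injective (S.twist a b) := by
  intro x w hxw
  rcases eq_or_ne x 0 with rfl | hx
  · by_contra hw
    exact hne w (Ne.symm hw) (hxw.symm.trans (S.twist_zero a b))
  rcases eq_or_ne w 0 with rfl | hw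
  · exact absurd (hxw.trans (S.twist_zero a b)) (hne x hx)
  have hs := hne x hx
  obtain ⟨t, htdef⟩ : ∃ t, t = S.conj (S.twist a b x) / S.twist a b x := ⟨_, rfl⟩
  have ht : t * S.conj t = 1 := by
    have := S.conj_ne_zero hs
    rw [htdef, map_div₀, S.conj_conj]
    field_simp
  have ht0 := S.isUnit_root_ne_zero ht
  have h1 : S.conj (S.twist a b x) = t * S.twist a b x := by
    rw [htdef, div_mul_cancel₀ _ hs]
  have h2 := h.isUnitRoot_unique S ht ((S.isUnitRoot_iff hx ht).2 h1)
    ((S.isUnitRoot_iff hw ht).2 (hxw ▸ h1))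
  have hw' := S.conj_ne_zero hw
  have hl : S.conj (x / w) = x / w := by
    rw [map_div₀]
    field_simp at h2 ⊢
    linear_combination h2
  have hxl : x = x / w * w := by field_simp
  have h3 : x / w = 1 := by
    have := S.twist_mul a b w hl
    rw [← hxl, hxw] at this
    exact (mul_eq_right₀ (hxw ▸ hs)).1 this.symm
  rw [hxl, h3, one_mul]

lemma exists_norm_eq_one_of_twist_eq_zero {a b x : E} (ha : a ≠ 0) (hx : x ≠ 0)
    (h : S.twist a b x = 0) : ∃ t y, t * S.conj t = 1 ∧ y ≠ 0 ∧
      a * t + b * t ^ 2 = (a * y ^ 2 / S.conj a) ^ 2 ∧ b * y ^ 3 + y + S.conj a = 0 ∧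
      (a * t + b * t ^ 2) * S.conj (a * t + b * t ^ 2) = 1 := by
  have ha' := S.conj_ne_zero ha
  have hx' := S.conj_ne_zero hx
  obtain ⟨y, hy⟩ : ∃ y, y = S.conj x / x := ⟨_, rfl⟩
  have hyu : y * S.conj y = 1 := by
    rw [hy, map_div₀, S.conj_conj]
    field_simp
  have hy0 := S.isUnit_root_ne_zero hyu
  have hy0' := S.conj_ne_zero hy0
  have h3 : b * y ^ 3 + y + S.conj a = 0 := by
    rw [twist] at h
    field_simp at h
    rw [hy]
    field_simp
    linear_combination h
  have hyi : S.conj y = 1 / y := by rw [eq_div_iff hy0, mul_comm, hyu]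
  have he : a * (a * y ^ 3 / S.conj a) + b * (a * y ^ 3 / S.conj a) ^ 2 =
      (a * y ^ 2 / S.conj a) ^ 2 := by
    field_simp
    linear_combination h3 - y * CharTwo.two_eq_zero (R := E)
  refine ⟨a * y ^ 3 / S.conj a, y, ?_, hy0, he, h3, ?_⟩
  · simp only [map_div₀, map_mul, map_pow, S.conj_conj, hyi]
    field_simp
  · rw [he]
    simp only [map_div₀, map_mul, map_pow, S.conj_conj, hyi]
    field_simp

theorem bijective_twist_iff [Finite E] {a b : E} (ha : a ≠ 0) (hb : b ≠ 0) :
    Function.Bijective (S.twist a b) ↔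
      (b * S.conj a = a ∧ S.tr (1 + 1 / (a * S.conj a)) = 0) ∨
      (b * (1 + a * S.conj a + b * S.conj b) + a ^ 2 = 0 ∧ b * S.conj b ≠ 1 ∧
        S.tr (b * S.conj b / (a * S.conj a)) = 0) := by
  refine ⟨fun h => (S.admissible_of_bijective h).cases S ha hb, fun h => ?_⟩
  refine Finite.injective_iff_bijective.1 ?_
  rcases h with ⟨hab, htr⟩ | ⟨hab, hb1, htr⟩
  · have hadm := S.admissible_of_mul_conj ha hab htr
    refine hadm.injective S fun x hx h0 => ?_
    obtain ⟨t, y, ht, hy0, he, h3, hN⟩ := S.exists_norm_eq_one_of_twist_eq_zero ha hx h0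
    have ha' := S.conj_ne_zero ha
    have h1 : a * y ^ 2 / S.conj a = 1 := by
      apply CharTwo.sq_injective
      change (a * y ^ 2 / S.conj a) ^ 2 = 1 ^ 2
      rw [← he, (hadm t ht).1 hN, one_pow]
    rw [div_eq_one_iff_eq ha'] at h1
    have h2 : b * y ^ 2 = 1 := by
      apply mul_left_cancel₀ ha
      linear_combination b * h1 + hab
    apply ha'
    linear_combination h3 - y * h2 - y * CharTwo.two_eq_zero (R := E)
  · obtain ⟨hadm, hN⟩ := S.admissible_of_param ha hab hb1 htr
    refine hadm.injective S fun x hx h0 => ?_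
    obtain ⟨t, y, ht, -, -, -, hN1⟩ := S.exists_norm_eq_one_of_twist_eq_zero ha hx h0
    exact hN t ht hN1

end ConjTrace

section FiniteField

variable {E : Type*} [Field E] [CharP E 2]

lemma traceSum_add (n : ℕ) (x y : E) : traceSum n (x + y) = traceSum n x + traceSum n y := by
  simp only [traceSum, add_pow_char_pow, Finset.sum_add_distrib]

/-- `traceSum` as an additive map. -/
def traceHom (E : Type*) [Field E] [CharP E 2] (n : ℕ) : E →+ E :=
  AddMonoidHom.mk' (traceSum n) (traceSum_add n)

/-- The Artin–Schreier map `y ↦ y² + y`. -/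
def artinSchreier (E : Type*) [Field E] [CharP E 2] : E →+ E :=
  AddMonoidHom.mk' (fun y => y ^ 2 + y) fun x y => by rw [CharTwo.add_sq]; ring

lemma traceSum_sq_add_self (n : ℕ) (y : E) : traceSum n (y ^ 2 + y) = y ^ 2 ^ n + y := by
  induction n with
  | zero => simp [traceSum, CharTwo.add_self_eq_zero]
  | succ n ih =>
    rw [traceSum, Finset.sum_range_succ, ← traceSum, ih, add_pow_char_pow, ← pow_mul, ← pow_succ']
    linear_combination y ^ 2 ^ n * CharTwo.two_eq_zero (R := E)

omit [CharP E 2] in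
lemma traceSum_add_index (n k : ℕ) (x : E) :
    traceSum (n + k) x = traceSum n x + traceSum k (x ^ 2 ^ n) := by
  simp only [traceSum, Finset.sum_range_add, pow_add, pow_mul]

lemma card_ker_artinSchreier_le : Nat.card (artinSchreier E).ker ≤ 2 := by
  classical
  have h : ((artinSchreier E).ker : Set E) ⊆ (({0, 1} : Finset E) : Set E) := by
    intro y hy
    have hy : y ^ 2 + y = 0 := hy
    have : y * (y + 1) = 0 := by linear_combination hy
    rcases mul_eq_zero.1 this with h | h
    · simp [h]
    · simp [CharTwo.add_eq_zero.1 h]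
  calc Nat.card (artinSchreier E).ker = Set.ncard ((artinSchreier E).ker : Set E) := rfl
    _ ≤ Set.ncard (({0, 1} : Finset E) : Set E) := Set.ncard_le_ncard h (Finset.finite_toSet _)
    _ ≤ 2 := by
      rw [Set.ncard_coe_finset]
      exact Finset.card_le_two

open Polynomial in
lemma card_ker_traceHom_le (n : ℕ) : Nat.card (traceHom E (n + 1)).ker ≤ 2 ^ n := by
  classical
  obtain ⟨p, hp⟩ : ∃ p : E[X], p = ∑ j ∈ Finset.range n, X ^ 2 ^ j := ⟨_, rfl⟩
  have hdeg : p.degree < (2 ^ n : ℕ) := by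
    rw [hp]
    refine (degree_sum_le _ _).trans_lt ?_
    rw [Finset.sup_lt_iff (WithBot.bot_lt_coe _)]
    intro j hj
    rw [degree_X_pow]
    exact_mod_cast Nat.pow_lt_pow_right one_lt_two (Finset.mem_range.1 hj)
  have hne : X ^ 2 ^ n + p ≠ 0 := (monic_X_pow_add hdeg).ne_zero
  have hsub : ((traceHom E (n + 1)).ker : Set E) ⊆ ((X ^ 2 ^ n + p).roots.toFinset : Set E) := by
    intro y hy
    have hy : traceSum (n + 1) y = 0 := hy
    rw [Finset.mem_coe, Multiset.mem_toFinset, mem_roots hne, IsRoot, hp]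
    rw [traceSum, Finset.sum_range_succ] at hy
    rw [← hy]
    simp [eval_finsetSum, add_comm]
  calc Nat.card (traceHom E (n + 1)).ker = Set.ncard ((traceHom E (n + 1)).ker : Set E) := rfl
    _ ≤ Set.ncard ((X ^ 2 ^ n + p).roots.toFinset : Set E) :=
      Set.ncard_le_ncard hsub (Finset.finite_toSet _)
    _ ≤ (X ^ 2 ^ n + p).natDegree := by
      rw [Set.ncard_coe_finset]
      exact (Multiset.toFinset_card_le _).trans (card_roots' _)
    _ = 2 ^ n := natDegree_eq_of_degree_eq_some <| by
      rw [degree_add_eq_left_of_degree_lt (by rwa [degree_X_pow]), degree_X_pow]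

lemma exists_sq_add_self_of_traceSum_eq_zero [Fintype E] {n : ℕ}
    (hE : Fintype.card E = 2 ^ (n + 1)) {c : E} (hc : traceSum (n + 1) c = 0) :
    ∃ v, v ^ 2 + v = c := by
  have hle : (artinSchreier E).range ≤ (traceHom E (n + 1)).ker := by
    rintro _ ⟨y, rfl⟩
    change traceSum (n + 1) (y ^ 2 + y) = 0
    rw [traceSum_sq_add_self, ← hE, FiniteField.pow_card, CharTwo.add_self_eq_zero]
  have hcard := (artinSchreier E).ker.card_mul_index
  rw [AddSubgroup.index_ker, Nat.card_eq_fintype_card (α := E), hE, pow_succ'] at hcard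
  have h2 := Nat.mul_le_mul_right (Nat.card (artinSchreier E).range)
    (card_ker_artinSchreier_le (E := E))
  have heq := AddSubgroup.eq_of_le_of_card_ge hle
    ((card_ker_traceHom_le n).trans (by lia))
  have : c ∈ (artinSchreier E).range := heq ▸ (show c ∈ (traceHom E (n + 1)).ker from hc)
  exact this

omit [CharP E 2] in
lemma card_norm_one [Fintype E] {m : ℕ} (hE : Fintype.card E = (2 ^ m) ^ 2) :
    (Polynomial.nthRootsFinset (2 ^ m + 1) (1 : E)).card = 2 ^ m + 1 := by
  obtain ⟨g, hg⟩ := IsCyclic.exists_ofOrder_eq_natCard (α := Eˣ)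
  rw [Nat.card_units, Nat.card_eq_fintype_card, hE, ← one_pow 2, Nat.sq_sub_sq] at hg
  have hm : 2 ^ m - 1 ≠ 0 := by
    intro h
    have : (2 ^ m) ^ 2 = 1 := by
      rw [show 2 ^ m = 1 by have := Nat.one_le_two_pow (n := m); omega, one_pow]
    have h1 := Fintype.one_lt_card (α := E)
    omega
  have h2 : orderOf (g ^ (2 ^ m - 1)) = 2 ^ m + 1 := by
    rw [orderOf_pow_of_dvd hm (hg ▸ Dvd.intro_left _ rfl), hg,
      Nat.mul_div_cancel _ (Nat.pos_of_ne_zero hm)]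
  rw [← orderOf_units] at h2
  exact (h2 ▸ IsPrimitiveRoot.orderOf _ : IsPrimitiveRoot _ (2 ^ m + 1)).card_nthRootsFinset

open Polynomial in
lemma eq_zero_of_traceSum_const [Fintype E] {m : ℕ} (hE : Fintype.card E = (2 ^ m) ^ 2)
    (hm : m ≠ 0) (δ c : E)
    (h : ∀ ζ : E, ζ * ζ ^ 2 ^ m = 1 → traceSum m (δ * ζ + (δ * ζ) ^ 2 ^ m) = c) : δ = 0 := by
  obtain ⟨k, rfl⟩ := Nat.exists_eq_succ_of_ne_zero hm
  obtain ⟨p, hp⟩ : ∃ p : E[X], p = ∑ j ∈ Finset.range (k + 1),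
      (C (δ ^ 2 ^ j) * X ^ (2 ^ k + 2 ^ j) +
      C ((δ ^ 2 ^ (k + 1)) ^ 2 ^ j) * X ^ (2 ^ k - 2 ^ j)) + C c * X ^ 2 ^ k := ⟨_, rfl⟩
  have hle : ∀ j ∈ Finset.range (k + 1), 2 ^ j ≤ 2 ^ k := fun j hj =>
    Nat.pow_le_pow_right two_pos (Nat.lt_succ_iff.1 (Finset.mem_range.1 hj))
  have hdeg : p.natDegree ≤ 2 ^ (k + 1) := by
    rw [hp]
    refine natDegree_add_le_of_degree_le (natDegree_sum_le_of_forall_le _ _ fun j hj =>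
      natDegree_add_le_of_degree_le ((natDegree_C_mul_X_pow_le _ _).trans ?_)
        ((natDegree_C_mul_X_pow_le _ _).trans ?_)) ((natDegree_C_mul_X_pow_le _ _).trans ?_)
    all_goals
      try have := hle j hj
      rw [pow_succ]
      lia
  have hp0 : p = 0 := by
    refine eq_zero_of_natDegree_lt_card_of_eval_eq_zero' p
      (nthRootsFinset (2 ^ (k + 1) + 1) (1 : E)) (fun ζ hζ => ?_)
      (by rw [card_norm_one hE]; lia)
    rw [mem_nthRootsFinset (by positivity)] at hζ
    have hζ' : ζ * ζ ^ 2 ^ (k + 1) = 1 := by rw [← hζ, pow_succ' ζ]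
    have key : p.eval ζ =
        ζ ^ 2 ^ k * (traceSum (k + 1) (δ * ζ + (δ * ζ) ^ 2 ^ (k + 1)) + c) := by
      rw [hp, traceSum]
      simp only [eval_add, eval_finsetSum, eval_mul, eval_C, eval_pow, eval_X]
      rw [mul_add, Finset.mul_sum, mul_comm (ζ ^ 2 ^ k) c]
      congr 1
      refine Finset.sum_congr rfl fun j hj => ?_
      have h1 : ζ ^ 2 ^ k = ζ ^ (2 ^ k - 2 ^ j) * ζ ^ 2 ^ j := by
        rw [← pow_add, Nat.sub_add_cancel (hle j hj)]
      have h2 : ζ ^ 2 ^ j * (ζ ^ 2 ^ (k + 1)) ^ 2 ^ j = 1 := by rw [← mul_pow, hζ', one_pow]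
      rw [add_pow_char_pow, mul_pow δ ζ, mul_pow, mul_pow, pow_add, h1]
      linear_combination (-(ζ ^ (2 ^ k - 2 ^ j) * (δ ^ 2 ^ (k + 1)) ^ 2 ^ j)) * h2
    rw [key, h ζ hζ', CharTwo.add_self_eq_zero, mul_zero]
  have hcoeff : p.coeff (2 ^ (k + 1)) = δ ^ 2 ^ k := by
    rw [hp, coeff_add, finsetSum_coeff, Finset.sum_eq_single k]
    · have : 2 ^ k ≠ 0 := by positivity
      simp only [coeff_add, coeff_C_mul, coeff_X_pow, pow_succ]
      rw [if_pos (by lia), if_neg (by lia), if_neg (by lia)]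
      simp
    · intro j hj hjk
      have hlt : 2 ^ j < 2 ^ k := lt_of_le_of_ne (hle j hj) fun h =>
        hjk (Nat.pow_right_injective le_rfl h)
      simp only [coeff_add, coeff_C_mul, coeff_X_pow, pow_succ]
      rw [if_neg (by lia), if_neg (by lia)]
      simp
    · simp
  rw [hp0, coeff_zero] at hcoeff
  exact pow_eq_zero_iff (by positivity) |>.1 hcoeff.symm

/-- The structure on a field with `2^{2m}` elements given by `x ↦ x^{2^m}` and `traceSum m`. -/
def ConjTrace.ofCard [Fintype E] {m : ℕ} (hE : Fintype.card E = (2 ^ m) ^ 2) (hm : m ≠ 0) :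
    ConjTrace E where
  conj := iterateFrobenius E 2 m
  tr := traceHom E m
  conj_conj x := by
    rw [iterateFrobenius_def, iterateFrobenius_def, ← pow_mul, ← pow_two, ← hE,
      FiniteField.pow_card]
  tr_sq_add_self y := by
    rw [iterateFrobenius_def]
    exact traceSum_sq_add_self m y
  exists_sq_add_self c hc := by
    rw [iterateFrobenius_def] at hc
    obtain ⟨n, hn⟩ : ∃ n, m + m = n + 1 := ⟨m + m - 1, by lia⟩
    refine exists_sq_add_self_of_traceSum_eq_zero (n := n) ?_ ?_
    · rw [hE, ← hn, ← pow_mul, mul_two]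
    · rw [← hn, traceSum_add_index, hc, CharTwo.add_self_eq_zero]
  exists_sq x := (Finite.injective_iff_surjective.1 CharTwo.sq_injective) x
  eq_zero_of_tr_const δ c h := eq_zero_of_traceSum_const hE hm δ c fun ζ hζ => by
    have := h ζ
    simp only [iterateFrobenius_def] at this
    exact this hζ

end FiniteField

/-- The main theorem (conjecture of Tu–Zeng–Li–Helleseth):
`f(x) = x + α x^{q(q-1)+1} + β x^{2(q-1)+1}` permutes `F_{q^2}` iff
(1) `β = α^{q-1}` and `Tr(1 + 1/α^{q+1}) = 0`, or
(2) `β(1 + α^{q+1} + β^{q+1}) + α^{2q} = 0`, `β^{q+1} ≠ 1` and `Tr(β^{q+1}/α^{q+1}) = 0`. -/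
theorem stmt_2 {E : Type*} [Field E] [Fintype E] (m : ℕ) (hm : 3 ≤ m)
    (hE : Fintype.card E = (2 ^ m) ^ 2) (α β : E) (hαβ : α * β ≠ 0) :
    Function.Bijective
        (fun x : E => x + α * x ^ (2 ^ m * (2 ^ m - 1) + 1) + β * x ^ (2 * (2 ^ m - 1) + 1)) ↔
      ((β = α ^ (2 ^ m - 1) ∧ traceSum m (1 + 1 / α ^ (2 ^ m + 1)) = 0) ∨
        (β * (1 + α ^ (2 ^ m + 1) + β ^ (2 ^ m + 1)) + α ^ (2 * 2 ^ m) = 0 ∧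
          β ^ (2 ^ m + 1) ≠ 1 ∧
          traceSum m (β ^ (2 ^ m + 1) / α ^ (2 ^ m + 1)) = 0)) := by
  have : CharP E 2 := charP_of_card_eq_prime_pow (f := m * 2) (by rw [hE, pow_mul])
  have hα : α ≠ 0 := left_ne_zero_of_mul hαβ
  have hβ : β ≠ 0 := right_ne_zero_of_mul hαβ
  obtain ⟨S, hconj, htr⟩ : ∃ S : ConjTrace E, (∀ x, S.conj x = x ^ 2 ^ m) ∧
      ∀ x, S.tr x = traceSum m x :=
    ⟨.ofCard hE (by lia), fun x => iterateFrobenius_def 2 m x, fun _ => rfl⟩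
  obtain ⟨k, hk⟩ : ∃ k, 2 ^ m = k + 1 := ⟨2 ^ m - 1, by have := Nat.one_le_two_pow (n := m); lia⟩
  have hfun : (fun x : E => x + α * x ^ (2 ^ m * (2 ^ m - 1) + 1) +
      β * x ^ (2 * (2 ^ m - 1) + 1)) = S.twist (S.conj α) β := by
    funext x
    rcases eq_or_ne x 0 with rfl | hx
    · simp [ConjTrace.twist]
    have hx' := S.conj_ne_zero hx
    have h1 : x ^ (2 ^ m * (2 ^ m - 1) + 1) = x ^ 2 / S.conj x := by
      rw [eq_div_iff hx', hconj, ← pow_add]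
      have h := FiniteField.pow_card x
      rw [hE] at h
      calc x ^ (2 ^ m * (2 ^ m - 1) + 1 + 2 ^ m) = x ^ (2 ^ m) ^ 2 * x := by
            rw [← pow_succ, hk, Nat.add_sub_cancel]
            congr 1
            ring
        _ = x ^ 2 := by rw [h, pow_two]
    have h2 : x ^ (2 * (2 ^ m - 1) + 1) = S.conj x ^ 2 / x := by
      rw [eq_div_iff hx, hconj, ← pow_succ, ← pow_mul, hk, Nat.add_sub_cancel]
      congr 1
      ring
    rw [ConjTrace.twist, S.conj_conj, h1, h2]
  have hA : α ^ (2 ^ m + 1) = S.conj α * α := by rw [hconj, pow_succ]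
  have hB : β ^ (2 ^ m + 1) = β * S.conj β := by rw [hconj, pow_succ']
  have hα2 : α ^ (2 * 2 ^ m) = S.conj α ^ 2 := by rw [hconj, ← pow_mul, mul_comm]
  have hβα : β = α ^ (2 ^ m - 1) ↔ β * α = S.conj α := by
    rw [hconj, hk, Nat.add_sub_cancel, pow_succ, mul_left_inj' hα]
  rw [hfun, S.bijective_twist_iff (S.conj_ne_zero hα) hβ, S.conj_conj, hA, hB, hα2, hβα,
    htr, htr]
end

section
/- Let q = 2^m with m ≥ 3, i ∈ F_{q^2} with i^2 = i + k, Tr(k) = 1, and write α = A + iB, β = C + iD with A,B,C,D ∈ F_q, αβ ≠ 0. Then the conditions β(1 + α^{q+1} + β^{q+1}) + α^{2q} = 0, β^{q+1} ≠ 1, Tr(β^{q+1}/α^{q+1}) = 0, and β ∈ F_q hold simultaneously if and only if there exists ξ ∈ F_q \ {0,1} with A = ξ^2 + ξ, B = D = 0, C = ξ^2, and Tr(ξ/(ξ+1)) = 0. -/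
lemma traceSum_sq {F : Type*} [Field F] [CharP F 2] (m : ℕ) (z : F) :
    traceSum m (z ^ 2) = traceSum m z ^ 2 := by
  rw [traceSum, traceSum, sum_pow_char 2]
  exact Finset.sum_congr rfl fun j _ => by rw [← pow_mul, ← pow_mul, mul_comm]

lemma map_traceSum {F E : Type*} [Field F] [Field E] (f : F →+* E) (m : ℕ) (z : F) :
    f (traceSum m z) = traceSum m (f z) := by
  simp [traceSum]

/-- Iterating Frobenius on a root `i` of `X² = X + k` adds partial traces of `k`. -/
lemma pow_two_pow_eq_add_traceSum {E : Type*} [Field E] [CharP E 2] {i k : E}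
    (hi : i ^ 2 = i + k) (m : ℕ) : i ^ 2 ^ m = i + traceSum m k := by
  induction m with
  | zero => simp [traceSum]
  | succ n ih =>
    have hs : traceSum (n + 1) k = k + traceSum n k ^ 2 := by
      rw [← traceSum_sq, traceSum, Finset.sum_range_succ', add_comm]
      simp [traceSum, pow_succ' 2, pow_mul]
    rw [pow_succ, pow_mul, ih, add_pow_char, hi, hs, add_assoc]

/-- The equivalence over the base field, where `α = A` and `β = C`. -/
lemma base_field_conditions_iff {F : Type*} [Field F] [Fintype F] [CharP F 2] (m : ℕ) {A C : F}
    (hA : A ≠ 0) (hC : C ≠ 0) :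
    (C * (1 + A ^ 2 + C ^ 2) + A ^ 2 = 0 ∧ C ^ 2 ≠ 1 ∧ traceSum m (C ^ 2 / A ^ 2) = 0) ↔
      ∃ ξ : F, ξ ≠ 0 ∧ ξ ≠ 1 ∧ A = ξ ^ 2 + ξ ∧ C = ξ ^ 2 ∧ traceSum m (ξ / (ξ + 1)) = 0 := by
  have ratio (ξ : F) (h0 : ξ ≠ 0) :
      (ξ ^ 2) ^ 2 / (ξ ^ 2 + ξ) ^ 2 = (ξ / (ξ + 1)) ^ 2 := by
    rw [← div_pow, show ξ ^ 2 + ξ = ξ * (ξ + 1) by ring, sq ξ, mul_div_mul_left _ _ h0]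
  constructor
  · rintro ⟨he, h1, ht⟩
    obtain ⟨ξ, rfl⟩ : ∃ ξ : F, C = ξ ^ 2 := by
      obtain ⟨ξ, hξ⟩ := FiniteField.isSquare_of_char_two (ringChar.eq F 2) C
      exact ⟨ξ, by rw [hξ, sq]⟩
    have h0 : ξ ≠ 0 := by rintro rfl; simp at hC
    have hξ1 : ξ ≠ 1 := by rintro rfl; simp at h1
    have hne : ξ ^ 2 + 1 ≠ 0 := by
      intro h
      apply h1
      linear_combination (ξ ^ 2 - 1) * h
    have hAeq : A = ξ ^ 2 + ξ := by
      apply CharTwo.sq_injective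
      apply mul_left_cancel₀ hne
      change (ξ ^ 2 + 1) * A ^ 2 = (ξ ^ 2 + 1) * (ξ ^ 2 + ξ) ^ 2
      grind
    subst hAeq
    refine ⟨ξ, h0, hξ1, rfl, rfl, ?_⟩
    rw [ratio ξ h0, traceSum_sq] at ht
    exact pow_eq_zero_iff two_ne_zero |>.1 ht
  · rintro ⟨ξ, h0, h1, rfl, rfl, ht⟩
    refine ⟨by grind, fun h => h1 ?_, by rw [ratio ξ h0, traceSum_sq, ht, zero_pow two_ne_zero]⟩
    apply CharTwo.sq_injective
    apply CharTwo.sq_injective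
    simpa using h

/-- Case 1 of Proposition 2.1 is equivalent to condition (2) of the conjecture with `β ∈ F_q`. -/
theorem stmt_9 {F E : Type*} [Field F] [Fintype F] [Field E] [Fintype E] [Algebra F E]
    (m : ℕ) (hm : 3 ≤ m) (hF : Fintype.card F = 2 ^ m) (hE : Fintype.card E = (2 ^ m) ^ 2)
    (k : F) (hk : traceSum m k = 1) (i : E) (hi : i ^ 2 = i + algebraMap F E k)
    (A B C D : F) (α β : E)
    (hα : α = algebraMap F E A + i * algebraMap F E B)
    (hβ : β = algebraMap F E C + i * algebraMap F E D)
    (hαβ : α * β ≠ 0) :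
    (β * (1 + α ^ (2 ^ m + 1) + β ^ (2 ^ m + 1)) + α ^ (2 * 2 ^ m) = 0 ∧
        β ^ (2 ^ m + 1) ≠ 1 ∧
        traceSum m (β ^ (2 ^ m + 1) / α ^ (2 ^ m + 1)) = 0 ∧
        β ∈ Set.range (algebraMap F E)) ↔
      (∃ ξ : F, ξ ≠ 0 ∧ ξ ≠ 1 ∧ A = ξ ^ 2 + ξ ∧ B = 0 ∧ D = 0 ∧ C = ξ ^ 2 ∧
        traceSum m (ξ / (ξ + 1)) = 0) := by
  have : CharP F 2 := charP_of_card_eq_prime_pow hF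
  have : CharP E 2 := charP_of_injective_algebraMap (algebraMap F E).injective 2
  have hfrob (z : F) : algebraMap F E z ^ 2 ^ m = algebraMap F E z := by
    rw [← map_pow, ← hF, FiniteField.pow_card]
  have hiq : i ^ 2 ^ m = i + 1 := by
    rw [pow_two_pow_eq_add_traceSum hi, ← map_traceSum, hk, map_one]
  have hi_notMem (z : F) : algebraMap F E z ≠ i := by
    rintro rfl
    rw [hfrob] at hiq
    simp at hiq
  have hcoord (x y : F) (h : algebraMap F E x + i * algebraMap F E y = 0) : y = 0 := by
    by_contra hy
    have hy' : algebraMap F E y ≠ 0 := by simpa using hy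
    apply hi_notMem (-x / y)
    rw [map_div₀, map_neg, div_eq_iff hy']
    linear_combination -h
  have hαq : α ^ 2 ^ m = algebraMap F E A + (i + 1) * algebraMap F E B := by
    rw [hα, add_pow_char_pow, mul_pow, hfrob, hfrob, hiq]
  have reduced (hB : B = 0) (hD : D = 0) :
      (β * (1 + α ^ (2 ^ m + 1) + β ^ (2 ^ m + 1)) + α ^ (2 * 2 ^ m) = 0 ∧
        β ^ (2 ^ m + 1) ≠ 1 ∧ traceSum m (β ^ (2 ^ m + 1) / α ^ (2 ^ m + 1)) = 0) ↔
      ∃ ξ : F, ξ ≠ 0 ∧ ξ ≠ 1 ∧ A = ξ ^ 2 + ξ ∧ C = ξ ^ 2 ∧ traceSum m (ξ / (ξ + 1)) = 0 := by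
    subst hB hD
    simp only [map_zero, mul_zero, add_zero] at hα hβ
    subst hα hβ
    have hA : A ≠ 0 := by rintro rfl; simp at hαβ
    have hC : C ≠ 0 := by rintro rfl; simp at hαβ
    rw [← base_field_conditions_iff m hA hC, mul_comm 2 (2 ^ m)]
    simp only [pow_succ _ (2 ^ m), pow_mul, hfrob, ← sq]
    simp only [← map_pow, ← map_div₀, ← map_traceSum, ← map_one (algebraMap F E), ← map_add,
      ← map_mul, ne_eq, (algebraMap F E).injective.eq_iff, map_eq_zero]
  constructor
  · rintro ⟨he, h1, ht, z, hz⟩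
    have hD : D = 0 := by
      apply hcoord (C - z) D
      rw [map_sub, hz, hβ]
      ring
    have hB : B = 0 := by
      rw [mul_comm 2 (2 ^ m), pow_mul, pow_succ, pow_succ, hαq, hβ, hD, map_zero, mul_zero,
        add_zero, hfrob, hα] at he
      apply pow_eq_zero_iff two_ne_zero |>.1
      apply hcoord
        (C * (1 + (A ^ 2 + A * B + k * B ^ 2) + C ^ 2) + A ^ 2 + (k + 1) * B ^ 2) (B ^ 2)
      simp only [map_add, map_mul, map_pow, map_one]
      grind
    obtain ⟨ξ, h0, hξ1, hA, hC, hξ⟩ := (reduced hB hD).1 ⟨he, h1, ht⟩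
    exact ⟨ξ, h0, hξ1, hA, hB, hD, hC, hξ⟩
  · rintro ⟨ξ, h0, hξ1, hA, hB, hD, hC, hξ⟩
    obtain ⟨he, h1, ht⟩ := (reduced hB hD).2 ⟨ξ, h0, hξ1, hA, hC, hξ⟩
    exact ⟨he, h1, ht, C, by simp [hβ, hD]⟩
end
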